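/- arXiv:2202.03024 — 3 statements merged into one kernel-verified Lean document; each statement's English description precedes it below -/
import Mathlib

section
/- Let y be a binary word of length m with exactly R runs and run length profile (r_1, …, r_R), and let x be a binary word of length m+2 in I_2(y) whose run length profile is (r_1, …, r_i, 1, 1, r_{i+1}, …, r_R) for some i with 0 ≤ i ≤ R (i.e., x is obtained from y by inserting two new runs of length one after the i-th run). Then ω_y(x) = 1 + Σ_{j = b_i}^{f_i} r_j, where f_i is the smallest index in {i+1, …, R} with r_{f_i} > 1 (and f_i = R if no such index exists, and f_R = R), and b_i is the largest index in {1, …, i} with r_{b_i} > 1 (and b_i = 1 if no such index exists, and b_0 = 1). -/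
open scoped Classical

noncomputable section

/-- The embedding number `ω_y(x)`: the number of distinct occurrences of `y`
as a subsequence of `x` (i.e. the number of index tuples realizing `y` in `x`). -/
def emb {q : ℕ} (y x : List (Fin q)) : ℕ := x.sublists.count y

/-- The run length profile of a word: the list of lengths of its maximal
blocks of identical consecutive symbols, in order. -/
def runLengths {α : Type*} [DecidableEq α] : List α → List ℕ
  | [] => []
  | [_] => [1]
  | a :: b :: l =>
    if a = b then
      match runLengths (b :: l) with
      | [] => [1]
      | r :: rs => (r + 1) :: rs
    else 1 :: runLengths (b :: l)

/-- Input entropy `H^In_{k-Del}(y)` of the `k`-deletion channel over `Σ_q`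
under uniform transmission, for a channel output `y ∈ Σ_q^{n-k}`:
`-∑_{x ∈ I_k(y)} p(x) log₂ p(x)` with `p(x) = ω_y(x) / (C(n,k) q^k)`. -/
def Hdel (q n k : ℕ) (y : Fin (n - k) → Fin q) : ℝ :=
  - ∑ x ∈ Finset.univ.filter
      (fun x : Fin n → Fin q => (List.ofFn y).Sublist (List.ofFn x)),
      ((emb (List.ofFn y) (List.ofFn x) : ℝ) / ((n.choose k : ℝ) * (q : ℝ) ^ k)) *
        Real.logb 2 ((emb (List.ofFn y) (List.ofFn x) : ℝ) / ((n.choose k : ℝ) * (q : ℝ) ^ k))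

/-- Input entropy `H^In_{k-Ins}(y)` of the `k`-insertion channel over `Σ_q`
under uniform transmission, for a channel output `y ∈ Σ_q^{n+k}`:
`-∑_{x ∈ D_k(y)} p(x) log₂ p(x)` with `p(x) = ω_x(y) / C(n+k,k)`. -/
def Hins (q n k : ℕ) (y : Fin (n + k) → Fin q) : ℝ :=
  - ∑ x ∈ Finset.univ.filter
      (fun x : Fin n → Fin q => (List.ofFn x).Sublist (List.ofFn y)),
      ((emb (List.ofFn x) (List.ofFn y) : ℝ) / ((n + k).choose k : ℝ)) *
        Real.logb 2 ((emb (List.ofFn x) (List.ofFn y) : ℝ) / ((n + k).choose k : ℝ))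

/-- A run length profile `rl` of a word of length `m` with `R` runs is balanced if it
consists of `m mod R` runs of length `⌈m/R⌉` and `R - (m mod R)` runs of length `⌊m/R⌋`. -/
def isBalanced (m R : ℕ) (rl : List ℕ) : Prop :=
  rl.Perm (List.replicate (m % R) ((m + R - 1) / R) ++ List.replicate (R - m % R) (m / R))

/-- A run length profile `rl` of a word of length `m` with `R` runs is skewed if it
consists of `R - 1` runs of length `1` and a single run of length `m - (R-1)`. -/
def isSkewed (m R : ℕ) (rl : List ℕ) : Prop :=
  rl.Perm ((m - (R - 1)) :: List.replicate (R - 1) 1)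

/-- `fIdx rl i` is the smallest (1-based) index `j ∈ [i+1, R]` with `r_j > 1`;
it is `R` if no such index exists, and `fIdx rl R = R`. -/
def fIdx (rl : List ℕ) (i : ℕ) : ℕ :=
  if i = rl.length then rl.length
  else if {j | i + 1 ≤ j ∧ j ≤ rl.length ∧ 1 < rl.getD (j - 1) 0}.Nonempty
    then sInf {j | i + 1 ≤ j ∧ j ≤ rl.length ∧ 1 < rl.getD (j - 1) 0}
    else rl.length

/-- `bIdx rl i` is the largest (1-based) index `j ∈ [1, i]` with `r_j > 1`;
it is `1` if no such index exists, and `bIdx rl 0 = 1`. -/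
def bIdx (rl : List ℕ) (i : ℕ) : ℕ :=
  if i = 0 then 1
  else if {j | 1 ≤ j ∧ j ≤ i ∧ 1 < rl.getD (j - 1) 0}.Nonempty
    then sSup {j | 1 ≤ j ∧ j ≤ i ∧ 1 < rl.getD (j - 1) 0}
    else 1

/-- The binary word with first symbol `c` and the given run lengths. -/
def wordOfRuns (c : Fin 2) : List ℕ → List (Fin 2)
  | [] => []
  | r :: rs => List.replicate r c ++ wordOfRuns (c + 1) rs

/-- The sum of a list up to and including its first entry exceeding `1`. -/
def sumToFirstLong : List ℕ → ℕ
  | [] => 0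
  | r :: rs => if 1 < r then r else r + sumToFirstLong rs

/-- The sum of a list from its last entry exceeding `1` onwards. -/
def sumFromLastLong : List ℕ → ℕ
  | [] => 0
  | r :: rs => sumFromLastLong rs + if ∀ k ∈ rs, k ≤ 1 then r else 0

theorem emb_nil {q : ℕ} (x : List (Fin q)) : emb [] x = 1 := by
  unfold emb
  rw [(List.sublists_perm_sublists' x).count_eq]
  induction x with
  | nil => simp
  | cons a x ih =>
    rw [List.sublists'_cons, List.count_append, ih, List.count_eq_zero.2 (by simp)]

theorem emb_cons_self {q : ℕ} (a : Fin q) (y x : List (Fin q)) :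
    emb (a :: y) (a :: x) = emb y x + emb (a :: y) x := by
  unfold emb
  simp only [(List.sublists_perm_sublists' _).count_eq]
  rw [List.sublists'_cons, List.count_append,
    List.count_map_of_injective _ _ List.cons_injective, add_comm]

theorem emb_cons_of_ne {q : ℕ} {a b : Fin q} (h : b ≠ a) (y x : List (Fin q)) :
    emb (a :: y) (b :: x) = emb (a :: y) x := by
  unfold emb
  simp only [(List.sublists_perm_sublists' _).count_eq]
  rw [List.sublists'_cons, List.count_append, Nat.add_eq_left]
  exact List.count_eq_zero.2 (by simp [h])

theorem emb_eq_zero {q : ℕ} {y x : List (Fin q)} (h : ¬ y.Sublist x) : emb y x = 0 :=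
  List.count_eq_zero.2 (by simpa using h)

theorem emb_self {q : ℕ} (y : List (Fin q)) : emb y y = 1 := by
  induction y with
  | nil => exact emb_nil _
  | cons a y ih =>
    rw [emb_cons_self, ih, emb_eq_zero fun h => by simpa using h.length_le]

theorem emb_of_length_eq {q : ℕ} {y x : List (Fin q)} (h : y.length = x.length) :
    emb y x = if y = x then 1 else 0 := by
  split_ifs with hyx
  · rw [hyx, emb_self]
  · exact emb_eq_zero fun hs => hyx (hs.eq_of_length h)

theorem Fin.add_one_ne_self_two (c : Fin 2) : c + 1 ≠ c := by
  revert c; decide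

theorem Fin.add_one_add_one_two (c : Fin 2) : c + 1 + 1 = c := by
  revert c; decide

theorem length_wordOfRuns (c : Fin 2) (rs : List ℕ) : (wordOfRuns c rs).length = rs.sum := by
  induction rs generalizing c with
  | nil => rfl
  | cons r rs ih => simp [wordOfRuns, ih]

theorem exists_wordOfRuns_eq_cons (c : Fin 2) {rs : List ℕ} (hne : rs ≠ [])
    (hpos : ∀ r ∈ rs, 0 < r) : ∃ l, wordOfRuns c rs = c :: l := by
  match rs with
  | [] => exact absurd rfl hne
  | 0 :: _ => simp at hpos
  | (r + 1) :: rs => exact ⟨_, rfl⟩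

theorem exists_wordOfRuns_append_one_eq_cons (c : Fin 2) {rs : List ℕ} (ss : List ℕ)
    (hpos : ∀ r ∈ rs, 0 < r) : ∃ l, wordOfRuns c (rs ++ 1 :: ss) = c :: l := by
  match rs with
  | [] => exact ⟨_, rfl⟩
  | 0 :: _ => simp at hpos
  | (r + 1) :: rs => exact ⟨_, rfl⟩

theorem runLengths_pos {α : Type*} [DecidableEq α] (y : List α) :
    ∀ r ∈ runLengths y, 0 < r := by
  fun_induction runLengths y with
  | case1 => simp
  | case2 => simp
  | case3 => simp
  | case4 a l r rs h ih =>
    rw [h] at ih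
    simp_all
  | case5 a b l h ih => simpa using ih

theorem runLengths_cons_ne_nil {α : Type*} [DecidableEq α] (a : α) (y : List α) :
    runLengths (a :: y) ≠ [] := by
  cases y <;> simp only [runLengths]
  · simp
  · split_ifs
    · split <;> simp
    · simp

theorem wordOfRuns_runLengths (y : List (Fin 2)) :
    wordOfRuns y.headI (runLengths y) = y := by
  fun_induction runLengths y with
  | case1 => rfl
  | case2 => simp [wordOfRuns]
  | case3 a l h => exact absurd h (runLengths_cons_ne_nil _ _)
  | case4 a l r rs h ih =>
    rw [h] at ih
    simp only [wordOfRuns, List.headI_cons] at ih ⊢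
    rw [List.replicate_succ, List.cons_append, ih]
  | case5 a b l h ih =>
    have hb : a + 1 = b := by clear ih; revert a b; decide
    simpa [wordOfRuns, hb] using ih

theorem emb_replicate_succ {c : Fin 2} (k : ℕ) {z : List (Fin 2)} (hz : z.head? ≠ some c) :
    emb (List.replicate k c ++ z) (List.replicate (k + 1) c ++ z) = k + 1 := by
  induction k with
  | zero =>
    cases z with
    | nil => exact emb_nil _
    | cons a z =>
      have : c ≠ a := fun h => hz (by simp [h])
      simpa [emb_self] using emb_cons_of_ne this z (a :: z)
  | succ k ih =>
    rw [List.replicate_succ, List.replicate_succ, List.cons_append, List.cons_append,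
      emb_cons_self, ih, ← List.cons_append, ← List.replicate_succ, emb_self]

theorem head?_wordOfRuns_add_one_ne (c : Fin 2) {rs : List ℕ} (hpos : ∀ r ∈ rs, 0 < r) :
    (wordOfRuns (c + 1) rs).head? ≠ some c := by
  by_cases hne : rs = []
  · simp [hne, wordOfRuns]
  · obtain ⟨l, hl⟩ := exists_wordOfRuns_eq_cons (c + 1) hne hpos
    simp [hl]

/-- The embedding number when the two new runs are inserted at the front. -/
theorem emb_insert_front (c : Fin 2) {ss : List ℕ} (hpos : ∀ r ∈ ss, 0 < r) :
    emb (wordOfRuns c ss) (c :: (c + 1) :: wordOfRuns c ss) = 1 + sumToFirstLong ss := by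
  induction ss generalizing c with
  | nil => exact emb_nil _
  | cons r ss ih =>
    have hpos' : ∀ r ∈ ss, 0 < r := fun r hr => hpos r (List.mem_cons_of_mem _ hr)
    match r with
    | 0 => simp at hpos
    | 1 =>
      have := ih (c + 1) hpos'
      rw [Fin.add_one_add_one_two] at this
      simp only [wordOfRuns, List.replicate_one, List.singleton_append, sumToFirstLong]
      rw [emb_cons_self, this, emb_cons_of_ne (Fin.add_one_ne_self_two c), emb_self]
      simp; ring
    | k + 2 =>
      simp only [wordOfRuns, sumToFirstLong]
      have h := emb_replicate_succ (k + 1) (head?_wordOfRuns_add_one_ne c hpos')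
      rw [if_pos (by omega), List.replicate_succ, List.cons_append, emb_cons_self,
        emb_cons_of_ne (Fin.add_one_ne_self_two c), emb_self, ← List.cons_append,
        ← List.replicate_succ]
      rw [List.replicate_succ (n := k), List.cons_append,
        emb_cons_of_ne (Fin.add_one_ne_self_two c), ← List.cons_append, ← List.replicate_succ, h]
      ring

theorem cons_wordOfRuns_eq_tail_iff (c : Fin 2) {rs : List ℕ} (ss : List ℕ)
    (hpos : ∀ r ∈ rs, 0 < r) :
    c :: wordOfRuns (c + 1) (rs ++ ss) = (wordOfRuns (c + 1) (rs ++ 1 :: 1 :: ss)).tail ↔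
      ∀ k ∈ rs, k ≤ 1 := by
  induction rs generalizing c with
  | nil => simp [wordOfRuns, Fin.add_one_add_one_two]
  | cons r rs ih =>
    have hpos' : ∀ r ∈ rs, 0 < r := fun r hr => hpos r (List.mem_cons_of_mem _ hr)
    match r with
    | 0 => simp at hpos
    | 1 =>
      rw [List.forall_mem_cons, ← ih (c + 1) hpos']
      obtain ⟨l, hl⟩ := exists_wordOfRuns_append_one_eq_cons c (1 :: ss) hpos'
      simp [wordOfRuns, Fin.add_one_add_one_two, hl]
    | k + 2 =>
      simp [wordOfRuns, List.replicate_succ, (Fin.add_one_ne_self_two c).symm]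

theorem emb_cons_wordOfRuns (c : Fin 2) (r : ℕ) {rs : List ℕ} (ss : List ℕ)
    (hpos : ∀ r ∈ rs, 0 < r) :
    emb (c :: (List.replicate r c ++ wordOfRuns (c + 1) (rs ++ ss)))
      (List.replicate r c ++ wordOfRuns (c + 1) (rs ++ 1 :: 1 :: ss)) =
      if ∀ k ∈ rs, k ≤ 1 then 1 else 0 := by
  obtain ⟨l, hl⟩ := exists_wordOfRuns_append_one_eq_cons (c + 1) (1 :: ss) hpos
  have hlen : l.length = (rs ++ ss).sum + 1 := by
    have := congrArg List.length hl
    simp [length_wordOfRuns] at this ⊢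
    omega
  induction r with
  | zero =>
    have h := cons_wordOfRuns_eq_tail_iff c ss hpos
    simp only [hl, List.tail_cons] at h
    simp only [List.replicate_zero, List.nil_append, hl]
    rw [emb_cons_of_ne (Fin.add_one_ne_self_two c),
      emb_of_length_eq (by simp [length_wordOfRuns, hlen])]
    simp only [h]
  | succ r ih =>
    rw [List.replicate_succ, List.cons_append, List.cons_append, emb_cons_self, ih,
      Nat.add_eq_left, hl, emb_of_length_eq (by simp [length_wordOfRuns, hlen]; omega),
      if_neg]
    rw [← List.cons_append, ← List.cons_append, ← List.replicate_succ, ← List.replicate_succ,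
      List.replicate_add r 2, List.append_assoc, List.append_cancel_left_eq]
    simp [(Fin.add_one_ne_self_two c).symm]

theorem emb_wordOfRuns_insert (c : Fin 2) {rs ss : List ℕ} (hrs : ∀ r ∈ rs, 0 < r)
    (hss : ∀ r ∈ ss, 0 < r) :
    emb (wordOfRuns c (rs ++ ss)) (wordOfRuns c (rs ++ 1 :: 1 :: ss)) =
      1 + sumFromLastLong rs + sumToFirstLong ss := by
  induction rs generalizing c with
  | nil =>
    simpa [wordOfRuns, Fin.add_one_add_one_two, sumFromLastLong] using emb_insert_front c hss
  | cons r rs ih =>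
    have hrs' : ∀ r ∈ rs, 0 < r := fun r hr => hrs r (List.mem_cons_of_mem _ hr)
    clear hrs
    simp only [List.cons_append, wordOfRuns, sumFromLastLong]
    induction r with
    | zero => simpa using ih (c + 1) hrs'
    | succ r ihr =>
      rw [List.replicate_succ, List.cons_append, List.cons_append, emb_cons_self, ihr,
        emb_cons_wordOfRuns c r ss hrs']
      split_ifs <;> ring

theorem sum_range_eq_sumToFirstLong {L : List ℕ} {n : ℕ} (hn : n ≤ L.length)
    (hshort : ∀ k, k + 1 < n → L.getD k 0 ≤ 1)
    (hlong : n < L.length → 0 < n ∧ 1 < L.getD (n - 1) 0) :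
    ∑ k ∈ Finset.range n, L.getD k 0 = sumToFirstLong L := by
  induction L generalizing n with
  | nil => simp_all [sumToFirstLong]
  | cons r rs ih =>
    match n with
    | 0 => simp at hlong
    | 1 =>
      cases rs <;> simp_all [sumToFirstLong]
    | m + 2 =>
      have h0 : r ≤ 1 := by simpa using hshort 0 (by omega)
      rw [Finset.sum_range_succ', sumToFirstLong, if_neg (by omega), ← ih (n := m + 1)]
      · simp [add_comm]
      · simpa using hn
      · intro k hk
        simpa using hshort (k + 1) (by omega)
      · intro h
        simpa using hlong (by simp only [List.length_cons]; omega)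

theorem sum_Ico_eq_sumFromLastLong {L : List ℕ} {n : ℕ}
    (hshort : ∀ k, n < k → k < L.length → L.getD k 0 ≤ 1)
    (hlong : 0 < n → 1 < L.getD n 0) :
    ∑ k ∈ Finset.Ico n L.length, L.getD k 0 = sumFromLastLong L := by
  induction L generalizing n with
  | nil => simp [sumFromLastLong]
  | cons r rs ih =>
    rw [sumFromLastLong]
    match n with
    | 0 =>
      have hshort' : ∀ k, k < rs.length → rs.getD k 0 ≤ 1 := fun k hk => by
        simpa using hshort (k + 1) (by omega) (by simpa using hk)
      rw [if_pos, ← ih (n := 0) (fun k _ => hshort' k) (by simp)]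
      · simp [Finset.sum_range_succ']
      · intro k hk
        obtain ⟨j, hj, rfl⟩ := List.getElem_of_mem hk
        simpa [hj] using hshort' j hj
    | m + 1 =>
      have hm : 1 < rs.getD m 0 := by simpa using hlong
      rw [if_neg, ← ih (n := m) _ (fun _ => hm)]
      · simp [← Finset.sum_Ico_add' _ m rs.length 1]
      · intro k hk hk'
        simpa using hshort (k + 1) (by omega) (by simpa using hk')
      · intro h
        have hlt : m < rs.length := by
          by_contra hge
          rw [List.getD_eq_default _ _ (by omega)] at hm
          omega
        rw [List.getD_eq_getElem _ _ hlt] at hm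
        have := h _ (List.getElem_mem hlt)
        omega

theorem sum_Icc_fIdx {L : List ℕ} {i : ℕ} (hi : i ≤ L.length) :
    i ≤ fIdx L i ∧
      ∑ j ∈ Finset.Icc (i + 1) (fIdx L i), L.getD (j - 1) 0 = sumToFirstLong (L.drop i) := by
  obtain ⟨n, hn, hle, hshort, hlong⟩ : ∃ n, fIdx L i = i + n ∧ n ≤ (L.drop i).length ∧
      (∀ k, k + 1 < n → (L.drop i).getD k 0 ≤ 1) ∧
      (n < (L.drop i).length → 0 < n ∧ 1 < (L.drop i).getD (n - 1) 0) := by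
    unfold fIdx
    split_ifs with h1 h2
    · exact ⟨0, by simp [h1]⟩
    · obtain ⟨ha, hb, hc⟩ := Nat.sInf_mem h2
      have hmin := fun j => Nat.notMem_of_lt_sInf (m := j)
        (s := {j | i + 1 ≤ j ∧ j ≤ L.length ∧ 1 < L.getD (j - 1) 0})
      generalize sInf {j | i + 1 ≤ j ∧ j ≤ L.length ∧ 1 < L.getD (j - 1) 0} = f at *
      obtain ⟨n, rfl⟩ : ∃ n, f = i + 1 + n := Nat.exists_eq_add_of_le ha
      refine ⟨n + 1, by omega, by simp; omega, fun k hk => ?_, fun _ => ⟨by omega, ?_⟩⟩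
      · have := hmin (i + k + 1) (by omega)
        simp only [Set.mem_ofPred_eq, not_and, not_lt] at this
        simpa [List.getD_eq_getElem?_getD, List.getElem?_drop] using
          this (by omega) (by omega)
      · simpa [List.getD_eq_getElem?_getD, List.getElem?_drop,
          show i + 1 + n - 1 = i + n by omega] using hc
    · refine ⟨L.length - i, by omega, by simp, fun k hk => ?_, fun h => by simp at h⟩
      by_contra hlt
      refine h2 ⟨i + k + 1, by omega, by omega, ?_⟩
      simpa [List.getD_eq_getElem?_getD, List.getElem?_drop] using hlt
  refine ⟨by omega, ?_⟩
  rw [← sum_range_eq_sumToFirstLong hle hshort hlong, hn, ← Finset.Ico_add_one_right_eq_Icc,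
    Finset.sum_Ico_eq_sum_range, show i + n + 1 - (i + 1) = n by omega]
  refine Finset.sum_congr rfl fun k _ => ?_
  simp [List.getD_eq_getElem?_getD, List.getElem?_drop, show i + 1 + k - 1 = i + k by omega]

theorem sum_Icc_bIdx {L : List ℕ} {i : ℕ} (hi : i ≤ L.length) :
    bIdx L i ≤ i + 1 ∧
      ∑ j ∈ Finset.Icc (bIdx L i) i, L.getD (j - 1) 0 = sumFromLastLong (L.take i) := by
  have hlen : (L.take i).length = i := by simp [hi]
  have hget : ∀ k < i, (L.take i).getD k 0 = L.getD k 0 := fun k hk => by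
    simp [List.getD_eq_getElem?_getD, hk]
  obtain ⟨n, hn, hle, hshort, hlong⟩ : ∃ n, bIdx L i = n + 1 ∧ n ≤ i ∧
      (∀ k, n < k → k < (L.take i).length → (L.take i).getD k 0 ≤ 1) ∧
      (0 < n → 1 < (L.take i).getD n 0) := by
    rw [hlen]
    unfold bIdx
    split_ifs with h1 h2
    · exact ⟨0, by simp [h1]⟩
    · have hbdd : BddAbove {j | 1 ≤ j ∧ j ≤ i ∧ 1 < L.getD (j - 1) 0} := ⟨i, fun j hj => hj.2.1⟩
      obtain ⟨ha, hb, hc⟩ := Nat.sSup_mem h2 hbdd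
      have hmax := fun j => le_csSup (a := j) hbdd
      generalize sSup {j | 1 ≤ j ∧ j ≤ i ∧ 1 < L.getD (j - 1) 0} = b at *
      obtain ⟨n, rfl⟩ : ∃ n, b = n + 1 := ⟨b - 1, by omega⟩
      refine ⟨n, rfl, by omega, fun k hk hki => ?_, fun _ => ?_⟩
      · rw [hget k hki]
        by_contra hlt
        have := hmax (k + 1) ⟨by omega, by omega, by simpa using hlt⟩
        omega
      · rw [hget n (by omega)]
        exact hc
    · refine ⟨0, rfl, by omega, fun k _ hki => ?_, by simp⟩
      rw [hget k hki]
      by_contra hlt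
      exact h2 ⟨k + 1, by omega, by omega, by simpa using hlt⟩
  refine ⟨by omega, ?_⟩
  rw [← sum_Ico_eq_sumFromLastLong hshort hlong, hlen, hn, ← Finset.Ico_add_one_right_eq_Icc,
    ← Finset.sum_Ico_add' _ n i 1]
  refine Finset.sum_congr rfl fun k hk => ?_
  rw [hget k (Finset.mem_Ico.1 hk).2, Nat.add_sub_cancel]

/-- Let `y ∈ Σ_2^m` have run length profile `(r_1, …, r_R)` and let `x ∈ I_2(y)` be the
word obtained from `y` by inserting two new runs of length one after the `i`-th run
(so `x` starts with the same symbol as `y` and has run length profile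
`(r_1, …, r_i, 1, 1, r_{i+1}, …, r_R)`), for some `0 ≤ i ≤ R`. Then
`ω_y(x) = 1 + ∑_{j = b_i}^{f_i} r_j`, where `f_i` is the smallest index in `[i+1, R]`
with `r_{f_i} > 1` (with `f_i = R` if none exists and `f_R = R`) and `b_i` is the largest
index in `[1, i]` with `r_{b_i} > 1` (with `b_i = 1` if none exists and `b_0 = 1`). -/
theorem stmt_14 (y x : List (Fin 2)) (i : ℕ) (hi : i ≤ (runLengths y).length)
    (hxlen : x.length = y.length + 2) (hsub : y.Sublist x)
    (hhead : x.headI = y.headI)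
    (hprof : runLengths x =
      (runLengths y).take i ++ 1 :: 1 :: (runLengths y).drop i) :
    emb y x = 1 + ∑ j ∈ Finset.Icc (bIdx (runLengths y) i) (fIdx (runLengths y) i),
      (runLengths y).getD (j - 1) 0 := by
  have hpos := runLengths_pos y
  have hemb := emb_wordOfRuns_insert y.headI (rs := (runLengths y).take i)
    (ss := (runLengths y).drop i) (fun r hr => hpos r (List.mem_of_mem_take hr))
    (fun r hr => hpos r (List.mem_of_mem_drop hr))
  rw [List.take_append_drop, ← hprof, wordOfRuns_runLengths, ← hhead,
    wordOfRuns_runLengths] at hemb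
  obtain ⟨hb, hbsum⟩ := sum_Icc_bIdx hi
  obtain ⟨hf, hfsum⟩ := sum_Icc_fIdx hi
  rw [hemb, ← hbsum, ← hfsum, add_assoc]
  simp only [← Finset.Ico_add_one_right_eq_Icc]
  rw [Finset.sum_Ico_consecutive _ hb (by omega)]

end
end

section
/- Let y ∈ Σ_2^m and x ∈ Σ_2^n be binary words with m = n − k for some k ≥ 0, let α ∈ Σ_2, and let y' = α∘y and x' = α∘x be the words obtained by prepending α to y and x respectively. Then ω_{y'}(x') = ω_y(x) + Σ_{i=1}^{k} ω_y(x_{[i+1,n]}) · 𝟙[x_i = α], where x_{[i+1,n]} denotes the suffix of x starting at position i+1 and 𝟙 is the indicator function. -/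
open scoped Classical

noncomputable section

theorem emb_cons_cons {q : ℕ} (a b : Fin q) (y x : List (Fin q)) :
    emb (a :: y) (b :: x) = emb (a :: y) x + if b = a then emb y x else 0 := by
  unfold emb
  rw [(List.sublists_perm_sublists' (b :: x)).count_eq, (List.sublists_perm_sublists' x).count_eq,
    (List.sublists_perm_sublists' x).count_eq, List.sublists'_cons, List.count_append]
  congr 1
  split_ifs with h
  · subst h
    exact List.count_map_of_injective _ _ (List.cons_injective) _
  · refine List.count_eq_zero.mpr fun hmem => ?_
    obtain ⟨z, -, hz⟩ := List.mem_map.mp hmem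
    exact h (List.cons.inj hz).1

theorem emb_eq_zero_of_length_lt {q : ℕ} {y x : List (Fin q)} (h : x.length < y.length) :
    emb y x = 0 :=
  List.count_eq_zero.mpr fun hmem =>
    absurd (List.mem_sublists.mp hmem).length_le (Nat.not_le.mpr h)

/-- Occurrences of `α∘y` in `x`, sorted by the position at which the initial `α` is placed. -/
theorem emb_cons_eq_sum (y x : List (Fin 2)) (k : ℕ) (hlen : x.length = y.length + k)
    (α : Fin 2) :
    emb (α :: y) x =
      ∑ i ∈ Finset.range k, if x.getD i 0 = α then emb y (x.drop (i + 1)) else 0 := by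
  induction k generalizing x with
  | zero => simpa using emb_eq_zero_of_length_lt (by simp [hlen])
  | succ k ih =>
    cases x with
    | nil => simp at hlen
    | cons b x =>
      rw [emb_cons_cons, Finset.sum_range_succ', ih x (by simp at hlen; omega)]
      simp

/-- Let `y ∈ Σ_2^m` and `x ∈ Σ_2^n` with `m = n - k`, and let `α ∈ Σ_2`. Prepending `α`
to both words gives
`ω_{α∘y}(α∘x) = ω_y(x) + ∑_{i=1}^{k} ω_y(x_{[i+1, n]}) · 𝟙[x_i = α]`. -/
theorem stmt_15 (y x : List (Fin 2)) (k : ℕ) (hlen : x.length = y.length + k)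
    (α : Fin 2) :
    emb (α :: y) (α :: x) =
      emb y x + ∑ i ∈ Finset.Icc 1 k,
        (if x.getD (i - 1) 0 = α then emb y (x.drop i) else 0) := by
  rw [emb_cons_cons, if_pos rfl, emb_cons_eq_sum y x k hlen, add_comm, Finset.range_eq_Ico,
    ← Finset.Ico_add_one_right_eq_Icc, ← Finset.sum_Ico_add' _ 0 k 1]
  simp only [Nat.add_sub_cancel]

end
end

section
/- For all integers q ≥ 2, m ≥ 2, and r with 1 ≤ r < m, the total number of runs of length exactly r, summed over all words in Σ_q^m, equals (q−1)·q^{m−r−1}·((q−1)(m−r+1) + 2). -/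
open scoped Classical

noncomputable section

theorem runLengths_cons_eq {α : Type*} [DecidableEq α] (a : α) (l : List α) :
    ∃ s rs, runLengths (a :: l) = (s + 1) :: rs := by
  induction l generalizing a with
  | nil => exact ⟨0, [], by simp [runLengths]⟩
  | cons b l ih =>
    obtain ⟨s, rs, h⟩ := ih b
    by_cases hab : a = b
    · exact ⟨s + 1, rs, by rw [runLengths, if_pos hab, h]⟩
    · exact ⟨0, (s + 1) :: rs, by rw [runLengths, if_neg hab, h]⟩

/-- The indicator that the first run of a word has length `r`. -/
def headRunCount {α : Type*} [DecidableEq α] (r : ℕ) (l : List α) : ℕ :=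
  ((runLengths l).take 1).count r

/-- The number of runs of length `r` in a word, the first run excluded. -/
def tailRunCount {α : Type*} [DecidableEq α] (r : ℕ) (l : List α) : ℕ :=
  ((runLengths l).drop 1).count r

theorem count_runLengths {α : Type*} [DecidableEq α] (r : ℕ) (l : List α) :
    (runLengths l).count r = headRunCount r l + tailRunCount r l := by
  rw [headRunCount, tailRunCount, ← List.count_append, List.take_append_drop]

theorem headRunCount_one_cons_cons {α : Type*} [DecidableEq α] (a b : α) (l : List α) :
    headRunCount 1 (a :: b :: l) = if a = b then 0 else 1 := by
  obtain ⟨s, rs, h⟩ := runLengths_cons_eq b l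
  split_ifs with hab <;> simp [headRunCount, runLengths, hab, h]

theorem headRunCount_add_two_cons_cons {α : Type*} [DecidableEq α] (r : ℕ) (a b : α)
    (l : List α) :
    headRunCount (r + 2) (a :: b :: l) = if a = b then headRunCount (r + 1) (b :: l) else 0 := by
  obtain ⟨s, rs, h⟩ := runLengths_cons_eq b l
  split_ifs with hab <;> simp [headRunCount, runLengths, hab, h, List.count_cons]

theorem tailRunCount_cons_cons {α : Type*} [DecidableEq α] (r : ℕ) (a b : α) (l : List α) :
    tailRunCount r (a :: b :: l) =
      if a = b then tailRunCount r (b :: l) else (runLengths (b :: l)).count r := by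
  obtain ⟨s, rs, h⟩ := runLengths_cons_eq b l
  split_ifs with hab <;> simp [tailRunCount, runLengths, hab, h]

/-- The sum of `f` over all words of length `n`. -/
def wordSum (α : Type*) [Fintype α] (n : ℕ) (f : List α → ℕ) : ℕ :=
  ∑ y : Fin n → α, f (List.ofFn y)

theorem wordSum_const (α : Type*) [Fintype α] (n c : ℕ) :
    wordSum α n (fun _ => c) = Fintype.card α ^ n * c := by
  classical
  simp [wordSum]

theorem wordSum_add (α : Type*) [Fintype α] (n : ℕ) (f g : List α → ℕ) :
    wordSum α n (fun l => f l + g l) = wordSum α n f + wordSum α n g :=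
  Finset.sum_add_distrib

theorem wordSum_succ {α : Type*} [Fintype α] (n : ℕ) (f : List α → ℕ) :
    wordSum α (n + 1) f = ∑ a : α, wordSum α n (fun l => f (a :: l)) := by
  simp only [wordSum]
  rw [← Fintype.sum_prod_type' (f := fun a (y : Fin n → α) => f (a :: List.ofFn y))]
  exact (Fintype.sum_equiv (Fin.consEquiv fun _ => α) _ _ fun p => by
    simp [Fin.consEquiv]).symm

theorem wordSum_add_two {α : Type*} [Fintype α] [DecidableEq α] (n : ℕ) {f g h : List α → ℕ}
    (hf : ∀ a b l, f (a :: b :: l) = if a = b then g (b :: l) else h (b :: l)) :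
    wordSum α (n + 2) f =
      wordSum α (n + 1) g + (Fintype.card α - 1) * wordSum α (n + 1) h := by
  have key (b : α) (l : List α) : ∑ a, f (a :: b :: l) =
      g (b :: l) + (Fintype.card α - 1) * h (b :: l) := by
    rw [← Finset.add_sum_erase _ _ (Finset.mem_univ b), hf, if_pos rfl,
      Finset.sum_congr rfl fun a ha => (hf a b l).trans (if_neg (Finset.ne_of_mem_erase ha))]
    simp [Finset.card_erase_of_mem]
  rw [wordSum_succ]
  simp only [wordSum_succ n]
  rw [Finset.sum_comm, Finset.mul_sum, ← Finset.sum_add_distrib]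
  refine Finset.sum_congr rfl fun b _ => ?_
  simp only [wordSum]
  rw [Finset.sum_comm, Finset.mul_sum, ← Finset.sum_add_distrib]
  exact Finset.sum_congr rfl fun y _ => key b _

theorem wordSum_headRunCount_of_lt (α : Type*) [Fintype α] [DecidableEq α] (r k : ℕ) :
    wordSum α (r + k + 2) (headRunCount (r + 1)) =
      (Fintype.card α - 1) * Fintype.card α ^ (k + 1) := by
  induction r with
  | zero =>
    rw [wordSum_add_two (g := fun _ => 0) (h := fun _ => 1) _ headRunCount_one_cons_cons,
      wordSum_const, wordSum_const]
    simp
  | succ r ih =>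
    rw [show r + 1 + k + 2 = (r + k + 1) + 2 by ring,
      wordSum_add_two (h := fun _ => 0) _ (headRunCount_add_two_cons_cons r), wordSum_const,
      ih]
    simp

theorem wordSum_headRunCount_self (α : Type*) [Fintype α] [DecidableEq α] (r : ℕ) :
    wordSum α (r + 1) (headRunCount (r + 1)) = Fintype.card α := by
  induction r with
  | zero => simp [wordSum, headRunCount, runLengths]
  | succ r ih =>
    rw [wordSum_add_two (h := fun _ => 0) _ (headRunCount_add_two_cons_cons r), wordSum_const,
      ih]
    simp

theorem wordSum_headRunCount_of_gt (α : Type*) [Fintype α] [DecidableEq α] {r n : ℕ}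
    (h : n < r) : wordSum α (n + 1) (headRunCount (r + 1)) = 0 := by
  induction n generalizing r with
  | zero => simp [wordSum, headRunCount, runLengths, h.ne']
  | succ n ih =>
    obtain ⟨r, rfl⟩ := Nat.exists_eq_add_of_lt (Nat.zero_lt_of_lt h)
    rw [Nat.zero_add] at h ⊢
    rw [wordSum_add_two (h := fun _ => 0) _ (headRunCount_add_two_cons_cons r), wordSum_const,
      ih (by omega)]
    simp

theorem wordSum_tailRunCount_add_two (α : Type*) [Fintype α] [DecidableEq α] (r n : ℕ) :
    wordSum α (n + 2) (tailRunCount r) = wordSum α (n + 1) (tailRunCount r) +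
      (Fintype.card α - 1) * (wordSum α (n + 1) (headRunCount r) +
        wordSum α (n + 1) (tailRunCount r)) := by
  rw [wordSum_add_two (g := tailRunCount r) (h := fun l => (runLengths l).count r) _
    (tailRunCount_cons_cons r), ← wordSum_add]
  simp only [count_runLengths]

theorem wordSum_tailRunCount_of_le (α : Type*) [Fintype α] [DecidableEq α] {r n : ℕ}
    (h : n ≤ r) : wordSum α (n + 1) (tailRunCount (r + 1)) = 0 := by
  induction n with
  | zero => simp [wordSum, tailRunCount, runLengths]
  | succ n ih =>
    rw [wordSum_tailRunCount_add_two, ih (by omega), wordSum_headRunCount_of_gt α h]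
    simp

theorem wordSum_tailRunCount (α : Type*) [Fintype α] [DecidableEq α] [Nonempty α] (r k : ℕ) :
    wordSum α (r + k + 2) (tailRunCount (r + 1)) = (Fintype.card α - 1) *
      Fintype.card α ^ k * (Fintype.card α + (Fintype.card α - 1) * k) := by
  induction k with
  | zero =>
    rw [add_zero, wordSum_tailRunCount_add_two, wordSum_tailRunCount_of_le α le_rfl,
      wordSum_headRunCount_self]
    simp
  | succ k ih =>
    rw [← add_assoc, wordSum_tailRunCount_add_two, show r + k + 1 + 1 = r + k + 2 from rfl, ih,
      wordSum_headRunCount_of_lt]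
    obtain ⟨p, hp⟩ := Nat.exists_eq_succ_of_ne_zero (Fintype.card_ne_zero (α := α))
    rw [hp, Nat.succ_sub_one, Nat.succ_eq_add_one]
    ring

/-- For `q ≥ 2`, `m ≥ 2` and `1 ≤ r < m`, the total number of runs of length exactly `r`
over all words in `Σ_q^m` equals `(q-1) q^{m-r-1} ((q-1)(m-r+1) + 2)`. -/
theorem stmt_19 (q m r : ℕ) (hq : 2 ≤ q) (hm : 2 ≤ m) (hr1 : 1 ≤ r) (hrm : r < m) :
    ∑ y : Fin m → Fin q, (runLengths (List.ofFn y)).count r =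
      (q - 1) * q ^ (m - r - 1) * ((q - 1) * (m - r + 1) + 2) := by
  obtain ⟨r, rfl⟩ := Nat.exists_eq_add_of_le' hr1
  obtain ⟨k, rfl⟩ := Nat.exists_eq_add_of_lt hrm
  obtain ⟨p, rfl⟩ := Nat.exists_eq_add_of_le' (one_le_two.trans hq)
  have h : wordSum (Fin (p + 1)) (r + k + 2) (fun l => (runLengths l).count (r + 1)) =
      (p + 1 - 1) * (p + 1) ^ k * ((p + 1 - 1) * (k + 2) + 2) := by
    simp only [count_runLengths]
    rw [wordSum_add, wordSum_headRunCount_of_lt, wordSum_tailRunCount, Fintype.card_fin,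
      Nat.add_sub_cancel]
    ring
  rw [show r + 1 + k + 1 = r + k + 2 by ring, show r + k + 2 - (r + 1) - 1 = k by omega,
    show r + k + 2 - (r + 1) + 1 = k + 2 by omega]
  exact h

end
end
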